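/- arXiv:2205.03556 — 2 statements merged into one kernel-verified Lean document; each statement's English description precedes it below -/
import Mathlib

section
/- Let Y⁻ and Y⁺ be real N×T matrices with columns y(0),…,y(T−1) and y(1),…,y(T) respectively, let σ² > 0, and define the sample covariance matrices Σ₀ = (1/T) Y⁻ (Y⁻)ᵀ and Σ₁ = (1/T) Y⁺ (Y⁻)ᵀ. Suppose Y⁻ (Y⁻)ᵀ − Tσ² I is positive definite. Then the causality-based estimator Â_c = Σ₁ (Σ₀ − σ² I)⁻¹ is the unique minimizer over all real N×N matrices A of the de-regularized least-squares objective Σ_{k=1}^{T} ‖ y(k) − A y(k−1) ‖² + β ‖A‖_F² with regularization parameter β = −Tσ². In particular, the objective is strictly convex under the stated positive-definiteness assumption. -/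
open Matrix

section

variable {m n : Type*} [Fintype m] [Fintype n]

lemma Matrix.sum_sq_eq_trace_mul_transpose (A : Matrix m n ℝ) :
    ∑ i, ∑ j, A i j ^ 2 = (A * Aᵀ).trace := by
  simp [trace, mul_apply, sq]

lemma Matrix.PosDef.trace_mul_mul_transpose_pos {M : Matrix n n ℝ} (hM : M.PosDef)
    {D : Matrix m n ℝ} (hD : D ≠ 0) : 0 < (D * M * Dᵀ).trace := by
  have row (i : m) : (D * M * Dᵀ) i i = star (D i) ⬝ᵥ (M *ᵥ D i) := by
    rw [dotProduct_mulVec]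
    rfl
  obtain ⟨i, hi⟩ := Function.ne_iff.mp hD
  refine Finset.sum_pos' (fun i _ => ?_) ⟨i, Finset.mem_univ i, ?_⟩
  · rw [diag_apply, row]
    exact hM.posSemidef.dotProduct_mulVec_nonneg _
  · rw [diag_apply, row]
    exact hM.dotProduct_mulVec_pos hi

lemma Matrix.PosDef.strictConvexOn_trace_mul_mul_transpose {M : Matrix n n ℝ} (hM : M.PosDef) :
    StrictConvexOn ℝ Set.univ fun D : Matrix m n ℝ => (D * M * Dᵀ).trace := by
  refine ⟨convex_univ, fun X _ Y _ hXY a b ha hb hab => ?_⟩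
  have hpos := mul_pos (mul_pos ha hb) (hM.trace_mul_mul_transpose_pos (sub_ne_zero.mpr hXY))
  obtain rfl : b = 1 - a := by linarith
  simp only [transpose_add, transpose_sub, transpose_smul, Matrix.add_mul, Matrix.mul_add,
    Matrix.sub_mul, Matrix.mul_sub, Matrix.smul_mul, Matrix.mul_smul, trace_add, trace_sub,
    trace_smul, smul_eq_mul] at hpos ⊢
  linarith

/-- Completing the square in a ridge-type least-squares objective, the parameter `c` being
of either sign. -/
lemma Matrix.trace_residual_sub_eq_add {p : Type*} [Fintype p] [DecidableEq n]
    (X : Matrix n p ℝ) (Y : Matrix m p ℝ) (c : ℝ) {A₀ : Matrix m n ℝ}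
    (h₀ : A₀ * (X * Xᵀ - c • (1 : Matrix n n ℝ)) = Y * Xᵀ) (A : Matrix m n ℝ) :
    ((Y - A * X) * (Y - A * X)ᵀ).trace - c * (A * Aᵀ).trace =
      ((A - A₀) * (X * Xᵀ - c • (1 : Matrix n n ℝ)) * (A - A₀)ᵀ).trace +
        ((Y * Yᵀ).trace - (Y * Xᵀ * A₀ᵀ).trace) := by
  have hsymm : (X * Xᵀ - c • (1 : Matrix n n ℝ))ᵀ = X * Xᵀ - c • (1 : Matrix n n ℝ) := by
    simp [transpose_sub, transpose_mul]
  have hcross : (A * (X * Xᵀ - c • (1 : Matrix n n ℝ)) * A₀ᵀ).trace = (Y * Xᵀ * Aᵀ).trace := by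
    rw [← trace_transpose, transpose_mul, transpose_mul, hsymm, transpose_transpose,
      ← Matrix.mul_assoc, h₀]
  have hYX : (A * X * Yᵀ).trace = (Y * Xᵀ * Aᵀ).trace := by
    rw [← trace_transpose]
    simp [transpose_mul, Matrix.mul_assoc]
  have hquad : (A * (X * Xᵀ - c • (1 : Matrix n n ℝ)) * Aᵀ).trace =
      (A * X * (Xᵀ * Aᵀ)).trace - c * (A * Aᵀ).trace := by
    simp [Matrix.mul_sub, Matrix.sub_mul, Matrix.mul_assoc]
  have hexpand : ((Y - A * X) * (Y - A * X)ᵀ).trace =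
      (Y * Yᵀ).trace - (A * X * Yᵀ).trace - (Y * Xᵀ * Aᵀ).trace +
        (A * X * (Xᵀ * Aᵀ)).trace := by
    simp only [transpose_sub, transpose_mul, Matrix.sub_mul, Matrix.mul_sub, trace_sub,
      Matrix.mul_assoc]
    ring
  rw [hexpand, Matrix.sub_mul A, h₀, Matrix.sub_mul, transpose_sub,
    Matrix.mul_sub (A * _), Matrix.mul_sub (Y * Xᵀ), trace_sub, trace_sub,
    trace_sub, hcross, hquad, hYX]
  ring

end

/-- The causality-based estimator `Â_c = Σ₁ (Σ₀ − σ² I)⁻¹` is the unique minimizer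
of the de-regularized least-squares objective
`Σ_{k=1}^T ‖y(k) − A y(k−1)‖² + β ‖A‖_F²` with `β = −T σ²`, provided
`Y⁻ (Y⁻)ᵀ − T σ² I` is positive definite; in particular the objective is strictly
convex. -/
theorem stmt6 {N T : ℕ} (hT : 0 < T)
    (Ym Yp : Matrix (Fin N) (Fin T) ℝ) (σ2 : ℝ) (hσ2 : 0 < σ2)
    (hpd : (Ym * Ymᵀ - ((T : ℝ) * σ2) • (1 : Matrix (Fin N) (Fin N) ℝ)).PosDef)
    (S0 S1 : Matrix (Fin N) (Fin N) ℝ)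
    (hS0 : S0 = (T : ℝ)⁻¹ • (Ym * Ymᵀ)) (hS1 : S1 = (T : ℝ)⁻¹ • (Yp * Ymᵀ))
    (Ac : Matrix (Fin N) (Fin N) ℝ)
    (hAc : Ac = S1 * (S0 - σ2 • (1 : Matrix (Fin N) (Fin N) ℝ))⁻¹)
    (J : Matrix (Fin N) (Fin N) ℝ → ℝ)
    (hJ : ∀ A, J A =
      (∑ k : Fin T, ∑ i, (Yp i k - A.mulVec (fun j => Ym j k) i) ^ 2) +
        (-(T : ℝ) * σ2) * ∑ i, ∑ j, A i j ^ 2) :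
    StrictConvexOn ℝ Set.univ J ∧ ∀ A : Matrix (Fin N) (Fin N) ℝ, A ≠ Ac → J Ac < J A := by
  have hT' : (T : ℝ) ≠ 0 := by positivity
  set M := Ym * Ymᵀ - ((T : ℝ) * σ2) • (1 : Matrix (Fin N) (Fin N) ℝ) with hM
  have hnormal : Ac * M = Yp * Ymᵀ := by
    have hcov : S0 - σ2 • (1 : Matrix (Fin N) (Fin N) ℝ) = (T : ℝ)⁻¹ • M := by
      rw [hS0, hM, smul_sub, smul_smul, inv_mul_cancel_left₀ hT']
    have hunit : IsUnit ((T : ℝ)⁻¹ • M).det := by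
      rw [← isUnit_iff_isUnit_det]
      exact (hpd.smul (by positivity : (0 : ℝ) < (T : ℝ)⁻¹)).isUnit
    have h : Ac * ((T : ℝ)⁻¹ • M) = (T : ℝ)⁻¹ • (Yp * Ymᵀ) := by
      rw [hAc, hcov, nonsing_inv_mul_cancel_right _ _ hunit, hS1]
    rw [Matrix.mul_smul] at h
    exact smul_right_injective _ (inv_ne_zero hT') h
  have hsq (A : Matrix (Fin N) (Fin N) ℝ) : J A = ((A - Ac) * M * (A - Ac)ᵀ).trace +
      ((Yp * Ypᵀ).trace - (Yp * Ymᵀ * Acᵀ).trace) := by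
    rw [← trace_residual_sub_eq_add Ym Yp _ hnormal, hJ, ← sum_sq_eq_trace_mul_transpose,
      ← sum_sq_eq_trace_mul_transpose, Finset.sum_comm, neg_mul, neg_mul, ← sub_eq_add_neg]
    rfl
  constructor
  · have h := (hpd.strictConvexOn_trace_mul_mul_transpose (m := Fin N)).translate_left (-Ac)
    rw [funext hsq]
    simpa [Function.comp_def, Pi.add_def, ← sub_eq_add_neg] using
      h.add_const ((Yp * Ypᵀ).trace - (Yp * Ymᵀ * Acᵀ).trace)
  · intro A hA
    rw [hsq A, hsq Ac, sub_self]
    simpa using hpd.trace_mul_mul_transpose_pos (sub_ne_zero.mpr hA)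
end

section
/- Let A be a real N×N matrix whose powers converge to the averaging matrix, i.e. A^k → (1/N) 𝟙𝟙ᵀ as k → ∞ (where 𝟙 ∈ ℝᴺ is the all-ones vector). Let α ≥ 0, ρ ∈ [0,1), and let η : ℕ → ℝᴺ be a noise sequence satisfying ‖η(k)‖_∞ ≤ α ρᵏ for all k and the zero-sum condition Σ_{k=0}^{∞} Σ_{i=1}^{N} η_i(k) = 0 (the series converges absolutely by the decay bound). Then the noisy iteration x(k+1) = A x(k) + η(k) converges: x(k) → (1/N) 𝟙 𝟙ᵀ x(0), i.e. every coordinate of x(k) converges to the average of the entries of the initial state x(0). -/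
open Matrix Filter Topology

/-- Variation of constants for an inhomogeneous linear recurrence. -/
theorem Matrix.eq_pow_mulVec_add_sum_of_recurrence {n R : Type*} [Fintype n] [DecidableEq n]
    [CommRing R] {A : Matrix n n R} {x η : ℕ → n → R}
    (hx : ∀ k, x (k + 1) = A *ᵥ x k + η k) (k : ℕ) :
    x k = A ^ k *ᵥ x 0 + ∑ j ∈ Finset.range k, A ^ (k - 1 - j) *ᵥ η j := by
  induction k with
  | zero => simp
  | succ k ih =>
    have h : ∀ j ∈ Finset.range k,
        A *ᵥ (A ^ (k - 1 - j) *ᵥ η j) = A ^ (k + 1 - 1 - j) *ᵥ η j := fun j hj => by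
      have hj' := Finset.mem_range.mp hj
      rw [mulVec_mulVec, ← pow_succ', show k - 1 - j + 1 = k + 1 - 1 - j by omega]
    rw [hx, Finset.sum_range_succ, ← Finset.sum_congr rfl h, ih, mulVec_add, mulVec_mulVec,
      ← pow_succ', mulVec_sum]
    simp [add_assoc]

section LinftyOpNorm

attribute [local instance] Matrix.linftyOpNormedRing

/-- If `B k → J` and `v` is absolutely summable, the discrete convolutions of `B` and `v`
converge to `∑' j, J *ᵥ v j`. -/
theorem Matrix.tendsto_sum_range_mulVec {n : Type*} [Fintype n] [DecidableEq n]
    {B : ℕ → Matrix n n ℝ} {J : Matrix n n ℝ} (hB : Tendsto B atTop (𝓝 J))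
    {v : ℕ → n → ℝ} (hv : Summable fun j => ‖v j‖) :
    Tendsto (fun k => ∑ j ∈ Finset.range k, B (k - 1 - j) *ᵥ v j) atTop
      (𝓝 (∑' j, J *ᵥ v j)) := by
  obtain ⟨C, hC⟩ := (Metric.isBounded_range_of_tendsto B hB).exists_norm_le
  have hC0 : 0 ≤ C := (norm_nonneg _).trans (hC _ (Set.mem_range_self 0))
  have hsum : ∀ k, ∑ j ∈ Finset.range k, B (k - 1 - j) *ᵥ v j =
      ∑' j, if j < k then B (k - 1 - j) *ᵥ v j else 0 := fun k => by
    rw [tsum_eq_sum (s := Finset.range k) fun j hj => if_neg (by simpa using hj)]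
    exact Finset.sum_congr rfl fun j hj => (if_pos (Finset.mem_range.mp hj)).symm
  simp_rw [hsum]
  refine tendsto_tsum_of_dominated_convergence (hv.mul_left C) (fun j => ?_)
    (Eventually.of_forall fun k j => ?_)
  · have hsub : Tendsto (fun k : ℕ => k - 1 - j) atTop atTop := by
      simp_rw [Nat.sub_sub]
      exact tendsto_sub_atTop_nat _
    have hmul : Continuous fun M : Matrix n n ℝ => M *ᵥ v j := by fun_prop
    refine ((hmul.tendsto J).comp (hB.comp hsub)).congr' ?_
    filter_upwards [eventually_gt_atTop j] with k hk
    simp [hk]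
  · split_ifs
    · exact (linfty_opNorm_mulVec _ _).trans
        (mul_le_mul_of_nonneg_right (hC _ (Set.mem_range_self _)) (norm_nonneg _))
    · simpa using mul_nonneg hC0 (norm_nonneg _)

end LinftyOpNorm

/-- Noisy consensus convergence: if `A^k → (1/N) 𝟙𝟙ᵀ`, the noises decay as
`‖η(k)‖_∞ ≤ α ρᵏ` with `ρ ∈ [0,1)`, and the total entry sum of the noises is zero,
then the iteration `x(k+1) = A x(k) + η(k)` converges to `(1/N) 𝟙 𝟙ᵀ x(0)`,
the average of the initial entries in every coordinate. -/
theorem stmt8 {N : ℕ} (hN : 0 < N) (A : Matrix (Fin N) (Fin N) ℝ)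
    (J : Matrix (Fin N) (Fin N) ℝ)
    (hJ : J = (N : ℝ)⁻¹ • Matrix.of (fun _ _ => (1 : ℝ)))
    (hA : Tendsto (fun k => A ^ k) atTop (nhds J))
    (α ρ : ℝ) (hα : 0 ≤ α) (hρ0 : 0 ≤ ρ) (hρ1 : ρ < 1)
    (η : ℕ → Fin N → ℝ) (hηbd : ∀ k i, |η k i| ≤ α * ρ ^ k)
    (hzero : (∑' k : ℕ, ∑ i, η k i) = 0)
    (x : ℕ → Fin N → ℝ) (x0 : Fin N → ℝ)
    (hx0 : x 0 = x0) (hx : ∀ k, x (k + 1) = A.mulVec (x k) + η k) :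
    Tendsto x atTop (nhds (J.mulVec x0)) := by
  have hη : Summable fun j => ‖η j‖ :=
    Summable.of_nonneg_of_le (fun _ => norm_nonneg _)
      (fun k => (pi_norm_le_iff_of_nonneg (mul_nonneg hα (pow_nonneg hρ0 k))).mpr (hηbd k))
      ((summable_geometric_of_lt_one hρ0 hρ1).mul_left α)
  have hs : HasSum (fun k => ∑ i, η k i) 0 := by
    rw [← hzero]
    exact (summable_sum fun i _ => Pi.summable.mp hη.of_norm i).hasSum
  have hJη : ∑' j, J *ᵥ η j = 0 := by
    refine (Pi.hasSum.mpr fun i => ?_).tsum_eq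
    have h := hs.mul_left (N : ℝ)⁻¹
    simpa [hJ, smul_mulVec, mulVec, dotProduct, Finset.mul_sum] using h
  have hmul : Continuous fun M : Matrix (Fin N) (Fin N) ℝ => M *ᵥ x0 := by fun_prop
  have h := ((hmul.tendsto J).comp hA).add (tendsto_sum_range_mulVec hA hη)
  rw [hJη, add_zero] at h
  refine h.congr fun k => ?_
  rw [eq_pow_mulVec_add_sum_of_recurrence hx k, hx0]
  rfl
end
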